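/- Let p and q be distinct primes, and let m₁ < m₂ < … be the increasing sequence of positive integers all of whose prime factors lie in {p, q}. Then there exists a constant c > 0 (depending on p and q) such that m_{j+1} − m_j ≥ c · m_j / (log m_j)^{c'} for all j ≥ 2, for some constant c' depending on p and q. -/

import Mathlib

section TijdemanAux

open Polynomial

/-- binomial polynomial -/
noncomputable def bp : ℕ → ℂ[X]
  | 0 => 1
  | (i+1) => bp i * (X - C (i:ℂ)) * C ((i+1:ℂ)⁻¹)

lemma bp_pascal (i : ℕ) : (bp (i+1)).comp (X + 1) = bp (i+1) + bp i := by
  induction i with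
  | zero => simp [bp]
  | succ i ih =>
    have h1 : (bp (i+2)) = bp (i+1) * (X - C ((i+1:ℕ):ℂ)) * C (((i+1:ℕ)+1:ℂ)⁻¹) := rfl
    have h2 : (bp (i+1)) = bp (i) * (X - C (i:ℂ)) * C ((i+1:ℂ)⁻¹) := rfl
    have h3 : bp i * (X - C (i:ℂ)) = bp (i+1) * C (i+1:ℂ) := by
      rw [h2, mul_assoc (bp i * (X - C (i:ℂ))), ← C_mul, inv_mul_cancel₀ (by norm_cast), C_1, mul_one]
    have hc : C (((i+1:ℕ)+1:ℂ)⁻¹) * C (((i+1:ℕ)+1:ℂ)) = 1 := by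
      rw [← C_mul, inv_mul_cancel₀ (by norm_cast), C_1]
    rw [h1, mul_comp, mul_comp, ih, sub_comp, X_comp, C_comp, C_comp]
    have e : (X + 1 - C ((i+1:ℕ):ℂ)) = X - C (i:ℂ) := by
      push_cast; rw [C_add, C_1]; ring
    rw [e, add_mul, h3]
    calc _ = bp (i+1) * (X - C ((i+1:ℕ):ℂ) + C (((i+1:ℕ)+1:ℂ))) * C (((i+1:ℕ)+1:ℂ)⁻¹) := by
            push_cast; simp only [C_add, C_1]; ring
      _ = _ := by linear_combination (bp (i+1)) * hc

lemma bp_prod (i : ℕ) : bp (i+1) = C ((i+1:ℂ)⁻¹) * X * ∏ m ∈ Finset.range i, (C ((m+1:ℂ)⁻¹) * X - 1) := by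
  induction i with
  | zero => simp [bp]
  | succ i ih =>
    have h1 : (bp (i+2)) = bp (i+1) * (X - C ((i+1:ℕ):ℂ)) * C (((i+1:ℕ)+1:ℂ)⁻¹) := rfl
    have hc : C ((i+1:ℂ)⁻¹) * C ((i+1:ℂ)) = 1 := by
      rw [← C_mul, inv_mul_cancel₀ (by norm_cast), C_1]
    rw [h1, ih, Finset.prod_range_succ]
    push_cast
    linear_combination (-X * (∏ x ∈ Finset.range i, (C ((x+1:ℂ)⁻¹) * X - 1)) * C ((i+1+1:ℂ)⁻¹)) * hc

/-- the subring of complex polynomials with integer coefficients -/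
noncomputable abbrev intPolys : Subring ℂ[X] := (mapRingHom (Int.castRingHom ℂ)).range

lemma C_int_mem (n : ℤ) : C (n:ℂ) ∈ intPolys := ⟨C n, by simp⟩
lemma X_mem_intPolys : (X:ℂ[X]) ∈ intPolys := ⟨X, by simp⟩

lemma bp_int (h d : ℕ) (hd : ∀ m, 1 ≤ m → m ≤ h → m ∣ d) (s : ℕ) :
    ∀ i, i ≤ h → (bp i).comp (C (s:ℂ) + C (d:ℂ) * X) ∈ intPolys := by
  have key : ∀ m : ℕ, m + 1 ≤ h → C ((m+1:ℂ)⁻¹) * (C (d:ℂ) * X) ∈ intPolys := by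
    intro m hm
    obtain ⟨e, he⟩ := hd (m+1) (by omega) hm
    have : C ((m+1:ℂ)⁻¹) * (C (d:ℂ) * X) = C ((e:ℤ):ℂ) * X := by
      rw [← mul_assoc, ← C_mul, he]
      push_cast
      have : (m+1:ℂ) ≠ 0 := by norm_cast
      rw [inv_mul_cancel_left₀ this]
    rw [this]
    exact mul_mem (C_int_mem _) X_mem_intPolys
  induction s with
  | zero =>
    intro i hi
    cases i with
    | zero => simp [bp]
    | succ i =>
      rw [bp_prod]
      simp only [Nat.cast_zero, C_0, zero_add, mul_comp, C_comp, X_comp, prod_comp, sub_comp, one_comp]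
      refine mul_mem (key i hi) (prod_mem ?_)
      intro m hm
      refine sub_mem (key m ?_) (one_mem _)
      have := Finset.mem_range.1 hm
      omega
  | succ s ih =>
    intro i hi
    cases i with
    | zero => simp [bp]
    | succ i =>
      have : (bp (i+1)).comp (C ((s+1:ℕ):ℂ) + C (d:ℂ) * X) =
        ((bp (i+1)).comp (X+1)).comp (C (s:ℂ) + C (d:ℂ) * X) := by
        rw [comp_assoc]; congr 1; simp; ring
      rw [this, bp_pascal, add_comp]
      exact add_mem (ih _ hi) (ih _ (by omega))

lemma bp_degree (i : ℕ) : (bp i).degree = i := by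
  induction i with
  | zero => simp [bp]
  | succ i ih =>
    have h1 : (bp (i+1)) = bp (i) * (X - C (i:ℂ)) * C ((i+1:ℂ)⁻¹) := rfl
    rw [h1, degree_mul, degree_mul, ih, degree_X_sub_C, degree_C (inv_ne_zero (by norm_cast))]
    simp

lemma bp_bound (M : ℕ) (z : ℂ) (hz : ‖z‖ ≤ M) (i : ℕ) : ‖(bp i).eval z‖ ≤ ((M+i).choose i : ℝ) := by
  induction i with
  | zero => simp [bp]
  | succ i ih =>
    have h1 : (bp (i+1)) = bp (i) * (X - C (i:ℂ)) * C ((i+1:ℂ)⁻¹) := rfl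
    rw [h1, eval_mul, eval_mul, norm_mul, norm_mul]
    simp only [eval_sub, eval_X, eval_C]
    have h2 : ‖z - i‖ ≤ (M+i+1:ℝ) := by
      calc _ ≤ ‖z‖ + ‖(i:ℂ)‖ := norm_sub_le _ _
        _ ≤ _ := by simp; linarith
    have h3 : ((M+(i+1)).choose (i+1) : ℝ) = (M+i).choose i * (M+i+1) * (i+1:ℝ)⁻¹ := by
      have := Nat.add_one_mul_choose_eq (M+i) i
      have h' : ((M:ℝ)+i+1) * (M+i).choose i = (M+i+1).choose (i+1) * (i+1) := by exact_mod_cast this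
      rw [← add_assoc, eq_mul_inv_iff_mul_eq₀ (by positivity)]
      linarith
    have h4 : ‖(i+1:ℂ)⁻¹‖ = (i+1:ℝ)⁻¹ := by
      rw [norm_inv]; congr 1; exact_mod_cast Complex.norm_natCast (i+1)
    rw [h3, h4]
    gcongr

/-- The Feldman type basis: degree `j` -/
noncomputable def fq (h j : ℕ) : ℂ[X] := bp h ^ (j / h) * bp (j % h)

lemma fq_degree (h j : ℕ) : (fq h j).degree = j := by
  rw [fq, degree_mul, degree_pow, bp_degree, bp_degree, nsmul_eq_mul]
  norm_cast
  rw [Nat.div_add_mod']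

lemma fq_bound (h l0 j M : ℕ) (hh : 0 < h) (hj : j < l0 * h) (z : ℂ) (hz : ‖z‖ ≤ M) :
    ‖(fq h j).eval z‖ ≤ 2 ^ ((M + h) * l0) := by
  have h1 : ∀ i ≤ h, ‖(bp i).eval z‖ ≤ 2 ^ (M+h) := by
    intro i hi
    refine (bp_bound M z hz i).trans ?_
    calc ((M+i).choose i : ℝ) ≤ 2 ^ (M+i) := by exact_mod_cast Nat.choose_le_two_pow _ _
      _ ≤ _ := by gcongr; norm_num
  rw [fq, eval_mul, eval_pow, norm_mul, norm_pow]
  have h2 : j / h + 1 ≤ l0 := (Nat.div_lt_iff_lt_mul hh).2 hj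
  calc _ ≤ ((2:ℝ) ^ (M+h)) ^ (j/h) * 2 ^ (M+h) := by
        gcongr
        · exact h1 h le_rfl
        · exact h1 _ (Nat.mod_lt _ hh).le
    _ = (2 ^ (M+h)) ^ (j/h + 1) := by rw [pow_succ]
    _ ≤ (2 ^ (M+h)) ^ l0 := by
        gcongr
        exact one_le_pow₀ (by norm_num)
    _ = _ := by rw [pow_mul]

lemma poly_iter_deriv (P : ℂ[X]) (τ : ℕ) :
    deriv^[τ] (fun z => P.eval z) = fun z => (derivative^[τ] P).eval z := by
  induction τ generalizing P with
  | zero => rfl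
  | succ n ih =>
    rw [Function.iterate_succ_apply, Function.iterate_succ_apply, ← ih]
    congr 1
    ext z
    exact P.deriv

lemma fq_deriv_bound (h l0 j M : ℕ) (hh : 0 < h) (hj : j < l0 * h) (τ : ℕ) (z : ℂ) (hz : ‖z‖ + 1 ≤ M) :
    ‖(derivative^[τ] (fq h j)).eval z‖ ≤ τ.factorial * 2 ^ ((M + h) * l0) := by
  have := Complex.norm_iteratedDeriv_le_of_forall_mem_sphere_norm_le (f := fun z => (fq h j).eval z) τ
    (c := z) (R := 1) (C := 2 ^ ((M + h) * l0)) one_pos (by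
      exact (fq h j).differentiable.diffContOnCl) (by
      intro u hu
      refine fq_bound h l0 j M hh hj u ?_
      have : ‖u - z‖ = 1 := by simpa using hu
      calc ‖u‖ = ‖z + (u - z)‖ := by ring_nf
        _ ≤ ‖z‖ + ‖u - z‖ := norm_add_le _ _
        _ ≤ M := by rw [this]; exact hz)
  rw [iteratedDeriv_eq_iterate, poly_iter_deriv] at this
  simpa using this

lemma fq_int (h d : ℕ) (hh : 0 < h) (hd : ∀ m, 1 ≤ m → m ≤ h → m ∣ d) (s j τ : ℕ) :
    ∃ c : ℤ, (d:ℂ) ^ τ * (derivative^[τ] (fq h j)).eval (s:ℂ) = τ.factorial * (c:ℂ) := by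
  have : (fq h j).comp (C (s:ℂ) + C (d:ℂ) * X) ∈ intPolys := by
    rw [fq, mul_comp, pow_comp]
    exact mul_mem (pow_mem (bp_int h d hd s h le_rfl) _) (bp_int h d hd s _ (Nat.mod_lt _ hh).le)
  obtain ⟨P, hP⟩ := this
  refine ⟨P.coeff τ, ?_⟩
  have h1 : ((taylor (s:ℂ) (fq h j)).comp (C (d:ℂ) * X)) = P.map (Int.castRingHom ℂ) := by
    rw [taylor_apply, comp_assoc]
    simp only [add_comp, X_comp, C_comp]
    rw [add_comm]
    exact hP.symm
  have h2 := congrArg (fun q => q.coeff τ) h1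
  simp only [comp_C_mul_X_coeff, taylor_coeff, coeff_map] at h2
  rw [← factorial_smul_hasseDeriv]
  simp only [eq_intCast] at h2
  rw [← h2]
  simp
  ring

lemma order_add_ge {f g : ℂ → ℂ} {c : ℂ} {n : ℕ∞} (hf : n ≤ analyticOrderAt f c)
    (hg : n ≤ analyticOrderAt g c) : n ≤ analyticOrderAt (f + g) c :=
  (le_min hf hg).trans le_analyticOrderAt_add

lemma order_mul_ge {f g : ℂ → ℂ} {c : ℂ} {n : ℕ∞} (hf : Differentiable ℂ f) (hg : Differentiable ℂ g)
    (h : n ≤ analyticOrderAt f c) : n ≤ analyticOrderAt (f * g) c := by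
  rw [analyticOrderAt_mul (hf.analyticAt c) (hg.analyticAt c)]
  exact h.trans le_self_add

lemma exists_psi_aux (m : ℕ) : ∃ ψ : ℂ → ℂ, Differentiable ℂ ψ ∧ (∀ z, ψ (z + 1) = ψ z + 1) ∧
    (((m + 1 : ℕ) : ℕ∞) ≤ analyticOrderAt ψ 0) ∧
    ∃ C : ℝ, 0 ≤ C ∧ ∀ z, ‖ψ z‖ ≤ Real.exp (C * (‖z‖ + 1)) := by
  induction m with
  | zero =>
    refine ⟨id, differentiable_id, fun z => rfl, by simp, 1, zero_le_one, ?_⟩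
    intro z
    simp only [id, one_mul]
    linarith [Real.add_one_le_exp (‖z‖ + 1)]
  | succ m ih =>
    obtain ⟨ψ, hd, hper, hord, C, hC0, hC⟩ := ih
    rw [natCast_le_analyticOrderAt (hd.analyticAt 0)] at hord
    obtain ⟨g, hg, hgeq⟩ := hord
    set c : ℂ := g 0 / (2 * Real.pi) ^ (m+1) with hc
    have hpi : (2 * (Real.pi:ℂ)) ≠ 0 := by
      simp [Real.pi_ne_zero]
    let sn : ℂ → ℂ := fun z => Complex.sin (2 * Real.pi * z)
    have hsn : Differentiable ℂ sn := by fun_prop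
    have hsn0 : sn 0 = 0 := by simp [sn]
    let k := dslope sn 0
    have hk : Differentiable ℂ k := by
      rw [← differentiableOn_univ] at hsn ⊢
      exact (Complex.differentiableOn_dslope Filter.univ_mem).2 hsn
    have hk0 : k 0 = 2 * Real.pi := by
      simp only [k, dslope_same]
      have : HasDerivAt sn (Complex.cos (2 * Real.pi * 0) * (2 * Real.pi * 1)) 0 :=
        ((hasDerivAt_id (0:ℂ)).const_mul (2 * (Real.pi:ℂ))).csin
      rw [this.deriv]; simp
    have hksn : ∀ z, sn z = z * k z := by
      intro z
      have := sub_smul_dslope sn 0 z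
      simp only [sub_zero, hsn0, smul_eq_mul] at this
      exact this.symm
    have hsndiff : Differentiable ℂ (fun z => ψ z - c * sn z ^ (m+1)) := by fun_prop
    refine ⟨fun z => ψ z - c * sn z ^ (m+1), hsndiff, ?_, ?_, ?_⟩
    · intro z
      have : sn (z + 1) = sn z := by
        simp only [sn, mul_add, mul_one]
        exact Complex.sin_periodic _
      simp only [hper, this]; ring
    · have h1 : (fun z => ψ z - c * sn z ^ (m+1)) =ᶠ[nhds 0]
          ((fun z : ℂ => (z - 0)^(m+1)) * (fun z => g z - c * k z ^ (m+1))) := by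
        filter_upwards [hgeq] with z hz
        simp only [hz, hksn, Pi.mul_apply, sub_zero, smul_eq_mul]
        ring
      have hG : AnalyticAt ℂ (fun z => g z - c * k z ^ (m+1)) 0 := by
        have := hk.analyticAt 0
        fun_prop
      rw [analyticOrderAt_congr h1, analyticOrderAt_mul (by fun_prop) hG]
      have h2 : (1:ℕ∞) ≤ analyticOrderAt (fun z => g z - c * k z ^ (m+1)) 0 := by
        rw [Order.one_le_iff_ne_zero, hG.analyticOrderAt_ne_zero, hk0, hc]
        field_simp
        simp
      have h3 : analyticOrderAt (fun z : ℂ => (z - 0)^(m+1)) 0 = ((m+1:ℕ):ℕ∞) :=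
        analyticOrderAt_centeredMonomial
      rw [h3]
      push_cast
      gcongr
    · have hs : ∀ z, ‖sn z‖ ≤ Real.exp (2 * Real.pi * (‖z‖+1)) := by
        intro z
        have h1 : ‖Complex.sin (2 * Real.pi * z)‖ ≤ Real.exp (2 * Real.pi * ‖z‖) := by
          have e : ∀ w : ℂ, ‖Complex.exp w‖ ≤ Real.exp ‖w‖ := fun w => by
            rw [Complex.norm_exp]; exact Real.exp_le_exp.2 (Complex.re_le_norm w)
          have hn : ‖(2 * Real.pi * z : ℂ)‖ = 2 * Real.pi * ‖z‖ := by
            simp [abs_of_pos Real.pi_pos]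
          rw [Complex.sin, norm_div, norm_mul, Complex.norm_I, mul_one]
          have := norm_sub_le (Complex.exp (-(2 * Real.pi * z) * Complex.I)) (Complex.exp ((2 * Real.pi * z) * Complex.I))
          have a1 := e (-(2 * Real.pi * z) * Complex.I)
          have a2 := e ((2 * Real.pi * z) * Complex.I)
          rw [norm_mul, norm_neg, Complex.norm_I, mul_one, hn] at a1
          rw [norm_mul, Complex.norm_I, mul_one, hn] at a2
          have : ‖(2:ℂ)‖ = 2 := by simp
          rw [this, div_le_iff₀ (by norm_num)]
          linarith
        refine h1.trans (Real.exp_le_exp.2 ?_)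
        nlinarith [Real.pi_pos]
      set D := ‖c‖ + C + (m+1) * (2 * Real.pi) + 1 with hD
      have hD0 : 0 ≤ D := by positivity
      refine ⟨D, hD0, fun z => ?_⟩
      have hz : 1 ≤ ‖z‖ + 1 := by linarith [norm_nonneg z]
      have h1 : ‖sn z ^ (m+1)‖ ≤ Real.exp ((m+1) * (2 * Real.pi) * (‖z‖+1)) := by
        rw [norm_pow]
        calc _ ≤ (Real.exp (2 * Real.pi * (‖z‖+1))) ^ (m+1) := by gcongr; exact hs z
          _ = _ := by rw [← Real.exp_nat_mul]; push_cast; ring_nf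
      have e1 : Real.exp (C * (‖z‖ + 1)) ≤ Real.exp (C * (‖z‖ + 1) + (m+1) * (2 * Real.pi) * (‖z‖+1)) :=
        Real.exp_le_exp.2 (le_add_of_nonneg_right (by positivity))
      have e2 : Real.exp ((m+1) * (2 * Real.pi) * (‖z‖+1)) ≤ Real.exp (C * (‖z‖ + 1) + (m+1) * (2 * Real.pi) * (‖z‖+1)) :=
        Real.exp_le_exp.2 (le_add_of_nonneg_left (by positivity))
      calc ‖ψ z - c * sn z ^ (m+1)‖ ≤ ‖ψ z‖ + ‖c‖ * ‖sn z ^ (m+1)‖ := by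
            rw [← norm_mul]; exact norm_sub_le _ _
        _ ≤ Real.exp (C * (‖z‖ + 1) + (m+1) * (2 * Real.pi) * (‖z‖+1)) +
            ‖c‖ * Real.exp (C * (‖z‖ + 1) + (m+1) * (2 * Real.pi) * (‖z‖+1)) := by
            gcongr
            · exact (hC z).trans e1
            · exact h1.trans e2
        _ = (‖c‖ + 1) * Real.exp (C * (‖z‖ + 1) + (m+1) * (2 * Real.pi) * (‖z‖+1)) := by ring
        _ ≤ Real.exp ((‖c‖ + 1) * (‖z‖+1)) * Real.exp (C * (‖z‖ + 1) + (m+1) * (2 * Real.pi) * (‖z‖+1)) := by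
            gcongr
            have := Real.add_one_le_exp ((‖c‖ + 1) * (‖z‖+1))
            nlinarith [norm_nonneg c]
        _ = _ := by rw [← Real.exp_add, hD]; ring_nf

lemma exists_psi (m : ℕ) : ∃ ψ : ℂ → ℂ, Differentiable ℂ ψ ∧ (∀ s : ℕ, ψ s = s) ∧
    (∀ s : ℕ, (m : ℕ∞) ≤ analyticOrderAt (deriv ψ) s) ∧
    ∃ C : ℝ, 0 ≤ C ∧ ∀ z, ‖ψ z‖ ≤ Real.exp (C * (‖z‖ + 1)) := by
  obtain ⟨ψ, hd, hper, hord, hC⟩ := exists_psi_aux m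
  have h0 : ψ 0 = 0 := by
    apply apply_eq_zero_of_analyticOrderAt_ne_zero
    intro h
    rw [h] at hord
    simp at hord
  have hper' : ∀ (s : ℕ) z, ψ (z + s) = ψ z + s := by
    intro s
    induction s with
    | zero => simp
    | succ s ih =>
      intro z
      push_cast
      rw [← add_assoc, hper, ih, add_assoc]
  have hs : ∀ s : ℕ, ψ s = s := by
    intro s
    have := hper' s 0
    rwa [zero_add, h0, zero_add] at this
  refine ⟨ψ, hd, hs, ?_, hC⟩
  intro s
  have h1 := (hd.analyticAt (s:ℂ)).analyticOrderAt_deriv_add_one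
  have h2 : (fun z => ψ z - ψ s) = ψ ∘ (fun z => z - (s:ℂ)) := by
    ext z
    have := hper' s (z - s)
    rw [sub_add_cancel] at this
    simp only [Function.comp, this, hs]; ring
  have h3 : deriv (fun z => z - (s:ℂ)) s ≠ 0 := by simp
  rw [h2, analyticOrderAt_comp_of_deriv_ne_zero (by fun_prop) h3, sub_self] at h1
  rw [← h1] at hord
  push_cast at hord
  exact (ENat.add_le_add_iff_right ENat.one_ne_top).1 hord

lemma divide_one (n : ℕ) (c : ℂ) : ∀ (f : ℂ → ℂ), Differentiable ℂ f → (n : ℕ∞) ≤ analyticOrderAt f c →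
    ∃ g : ℂ → ℂ, Differentiable ℂ g ∧ ∀ z, f z = (z - c) ^ n * g z := by
  induction n with
  | zero => intro f hf _; exact ⟨f, hf, by simp⟩
  | succ n ih =>
    intro f hf ho
    have h0 : f c = 0 := by
      apply apply_eq_zero_of_analyticOrderAt_ne_zero
      intro h
      rw [h] at ho
      simp at ho
    have hk : Differentiable ℂ (dslope f c) := by
      rw [← differentiableOn_univ] at hf ⊢
      exact (Complex.differentiableOn_dslope Filter.univ_mem).2 hf
    have he : f = (fun z => z - c) * dslope f c := by
      ext z
      have := sub_smul_dslope f c z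
      simp only [h0, sub_zero, smul_eq_mul] at this
      exact this.symm
    have ho2 : (n : ℕ∞) ≤ analyticOrderAt (dslope f c) c := by
      rw [he, analyticOrderAt_mul (by fun_prop) (hk.analyticAt c)] at ho
      have : analyticOrderAt (fun z => z - c) c = 1 := analyticOrderAt_id_sub_const_self
      rw [this] at ho
      push_cast at ho
      rw [add_comm (1:ℕ∞)] at ho
      exact (ENat.add_le_add_iff_right ENat.one_ne_top).1 ho
    obtain ⟨g, hg, hgz⟩ := ih _ hk ho2
    refine ⟨g, hg, fun z => ?_⟩
    rw [he, Pi.mul_apply, hgz]; ring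

lemma divide_all (n S : ℕ) (f : ℂ → ℂ) (hf : Differentiable ℂ f)
    (ho : ∀ s < S, (n : ℕ∞) ≤ analyticOrderAt f (s:ℂ)) :
    ∃ g : ℂ → ℂ, Differentiable ℂ g ∧ ∀ z, f z = (∏ s ∈ Finset.range S, (z - (s:ℂ)) ^ n) * g z := by
  induction S with
  | zero => exact ⟨f, hf, by simp⟩
  | succ S ih =>
    obtain ⟨g, hg, hgz⟩ := ih (fun s hs => ho s (by omega))
    have hP : Differentiable ℂ (fun z : ℂ => ∏ s ∈ Finset.range S, (z - (s:ℂ)) ^ n) := by fun_prop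
    have he : f = (fun z : ℂ => ∏ s ∈ Finset.range S, (z - (s:ℂ)) ^ n) * g := by
      ext z; exact hgz z
    have h0 : analyticOrderAt (fun z : ℂ => ∏ s ∈ Finset.range S, (z - (s:ℂ)) ^ n) (S:ℂ) = 0 := by
      rw [(hP.analyticAt _).analyticOrderAt_eq_zero]
      rw [Finset.prod_ne_zero_iff]
      intro s hs
      apply pow_ne_zero
      rw [sub_ne_zero]
      have := Finset.mem_range.1 hs
      exact_mod_cast this.ne'
    have h1 := ho S (by omega)
    rw [he, analyticOrderAt_mul (hP.analyticAt _) (hg.analyticAt _), h0, zero_add] at h1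
    obtain ⟨k, hk, hkz⟩ := divide_one n (S:ℂ) g hg h1
    refine ⟨k, hk, fun z => ?_⟩
    rw [hgz, hkz, Finset.prod_range_succ]; ring

lemma schwarz (n S S' : ℕ) (hSS : S ≤ S') (hS' : 0 < S') (f : ℂ → ℂ) (hf : Differentiable ℂ f)
    (ho : ∀ s < S, (n : ℕ∞) ≤ analyticOrderAt f (s:ℂ)) (M : ℝ)
    (hM : ∀ z, ‖z‖ ≤ 4 * S' → ‖f z‖ ≤ M) (x : ℕ) (hx : x < S') :
    ‖f x‖ ≤ M * Real.exp (-(S * n : ℝ)) := by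
  obtain ⟨g, hg, hgz⟩ := divide_all n S f hf ho
  have hSp : (0:ℝ) < S' := by exact_mod_cast hS'
  have hM0 : 0 ≤ M := (norm_nonneg _).trans (hM 0 (by simp))
  have hgb : ‖g x‖ ≤ M / (3 * S') ^ (S * n) := by
    refine Complex.norm_le_of_forall_mem_frontier_norm_le (U := Metric.ball 0 (4 * S'))
      Metric.isBounded_ball hg.diffContOnCl ?_ ?_
    · intro z hz
      rw [frontier_ball _ (by positivity)] at hz
      have hz' : ‖z‖ = 4 * S' := by simpa using hz
      have h1 := hM z hz'.le
      rw [hgz, norm_mul, norm_prod] at h1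
      have h2 : (3 * S' : ℝ) ^ (S * n) ≤ ∏ s ∈ Finset.range S, ‖(z - (s:ℂ)) ^ n‖ := by
        calc (3 * S' : ℝ) ^ (S * n) = ∏ s ∈ Finset.range S, (3 * S' : ℝ) ^ n := by
              rw [Finset.prod_const, Finset.card_range, ← pow_mul, mul_comm S n]
          _ ≤ _ := by
              apply Finset.prod_le_prod
              · intros; positivity
              · intro s hs
                rw [norm_pow]
                gcongr
                have h3 := norm_sub_norm_le z (s:ℂ)
                rw [hz', Complex.norm_natCast] at h3
                have : (s:ℝ) ≤ S' := by
                  have := Finset.mem_range.1 hs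
                  exact_mod_cast (by omega : s ≤ S')
                linarith
      rw [le_div_iff₀ (by positivity)]
      calc _ ≤ ‖g z‖ * ∏ s ∈ Finset.range S, ‖(z - (s:ℂ)) ^ n‖ := by gcongr
        _ ≤ M := by rw [mul_comm]; exact h1
    · apply subset_closure
      simp only [Metric.mem_ball, dist_zero_right, Complex.norm_natCast]
      have : (x:ℝ) < S' := by exact_mod_cast hx
      linarith
  have hp : ∏ s ∈ Finset.range S, ‖((x:ℂ) - (s:ℂ)) ^ n‖ ≤ (S':ℝ) ^ (S * n) := by
    calc _ ≤ ∏ s ∈ Finset.range S, (S' : ℝ) ^ n := by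
          apply Finset.prod_le_prod
          · intros; positivity
          · intro s hs
            rw [norm_pow]
            gcongr
            have h3 : ‖(x:ℂ) - (s:ℂ)‖ = |(x:ℝ) - s| := by
              rw [← Real.norm_eq_abs, ← Complex.norm_real]; push_cast; rfl
            rw [h3, abs_le]
            have := Finset.mem_range.1 hs
            have h4 : (s:ℝ) ≤ S' := by exact_mod_cast (by omega : s ≤ S')
            have h5 : (x:ℝ) ≤ S' := by exact_mod_cast hx.le
            constructor <;> linarith [(Nat.cast_nonneg s : (0:ℝ) ≤ s), (Nat.cast_nonneg x : (0:ℝ) ≤ x)]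
      _ = _ := by rw [Finset.prod_const, Finset.card_range, ← pow_mul, mul_comm]
  rw [hgz, norm_mul, norm_prod]
  calc _ ≤ (S':ℝ) ^ (S * n) * (M / (3 * S') ^ (S * n)) := by gcongr
    _ = M * ((3:ℝ) ^ (S*n))⁻¹ := by
        rw [mul_pow]; field_simp
    _ ≤ M * Real.exp (-(S * n : ℝ)) := by
        gcongr
        rw [Real.exp_neg]
        gcongr
        have : Real.exp (S * n : ℝ) = Real.exp 1 ^ (S * n) := by
          rw [← Real.exp_nat_mul]; push_cast; ring_nf
        rw [this]
        gcongr
        linarith [Real.exp_one_lt_d9]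

lemma zero_estimate {ι : Type*} [DecidableEq ι] (I : Finset ι) (μ : ι → ℂ)
    (hμ : Set.InjOn μ I) (hμ0 : ∀ i ∈ I, μ i ≠ 0) :
    ∀ (N : ℕ) (d : ι → ℕ) (P : ι → ℂ[X]), ∑ i ∈ I, d i = N → (∀ i ∈ I, (P i).degree < d i) →
      (∀ s < N, ∑ i ∈ I, (P i).eval (s:ℂ) * μ i ^ s = 0) → ∀ i ∈ I, P i = 0 := by
  intro N
  induction N with
  | zero =>
    intro d P hd hP _ i hi
    have h0 : d i = 0 := (Finset.sum_eq_zero_iff.1 hd) i hi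
    have := hP i hi
    rw [h0] at this
    rw [← degree_eq_bot]
    simpa using this
  | succ N ih =>
    intro d P hd hP hs
    have hex : ∃ i0 ∈ I, d i0 ≠ 0 := by
      by_contra! h
      rw [Finset.sum_eq_zero h] at hd
      omega
    obtain ⟨i0, hi0, hdi0⟩ := hex
    have htd : ∀ p : ℂ[X], p ≠ 0 → (taylor 1 p - p).degree < p.degree := by
      intro p hp
      exact degree_sub_lt_right (degree_taylor _ _) hp (leadingCoeff_taylor _ _)
    let P' : ι → ℂ[X] := fun i => C (μ i) * taylor 1 (P i) - C (μ i0) * P i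
    let d' : ι → ℕ := fun i => if i = i0 then d i - 1 else d i
    have hd' : ∑ i ∈ I, d' i = N := by
      have h1 : ∑ i ∈ I, d' i + 1 = ∑ i ∈ I, d i := by
        rw [← Finset.add_sum_erase I d' hi0, ← Finset.add_sum_erase I d hi0]
        have : ∑ i ∈ I.erase i0, d' i = ∑ i ∈ I.erase i0, d i := by
          apply Finset.sum_congr rfl
          intro i hi
          simp [d', (Finset.mem_erase.1 hi).1]
        rw [this]
        simp only [d', if_true]
        omega
      omega
    have hP' : ∀ i ∈ I, (P' i).degree < d' i := by
      intro i hi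
      by_cases hii : i = i0
      · subst hii
        have e : P' i = C (μ i) * (taylor 1 (P i) - P i) := by simp only [P']; ring
        by_cases hp : P i = 0
        · rw [e, hp]; simp
        · have h1 := htd _ hp
          have h2 := hP i hi
          rw [e, degree_C_mul (hμ0 i hi)]
          simp only [d', if_true]
          rw [degree_eq_natDegree hp] at h1 h2
          have h2' : (P i).natDegree < d i := by exact_mod_cast h2
          refine h1.trans_le ?_
          exact_mod_cast (by omega)
      · simp only [d', if_neg hii]
        refine (degree_sub_le _ _).trans_lt (max_lt ?_ ?_)
        · refine (degree_mul_le _ _).trans_lt ?_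
          rw [degree_taylor, degree_C (hμ0 i hi), zero_add]; exact hP i hi
        · refine (degree_mul_le _ _).trans_lt ?_
          rw [degree_C (hμ0 i0 hi0), zero_add]; exact hP i hi
    have hz := ih d' P' hd' hP' (by
      intro s hsN
      have h1 := hs s (by omega)
      have h2 := hs (s+1) (by omega)
      have : ∑ i ∈ I, (P' i).eval (s:ℂ) * μ i ^ s =
        ∑ i ∈ I, (P i).eval ((s+1:ℕ):ℂ) * μ i ^ (s+1) - μ i0 * ∑ i ∈ I, (P i).eval (s:ℂ) * μ i ^ s := by
        rw [Finset.mul_sum, ← Finset.sum_sub_distrib]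
        apply Finset.sum_congr rfl
        intro i hi
        simp only [P', eval_sub, eval_mul, eval_C, taylor_eval]
        push_cast
        ring
      rw [this, h1, h2]; simp)
    have hne : ∀ i ∈ I, i ≠ i0 → P i = 0 := by
      intro i hi hii
      by_contra hp
      have h1 := hz i hi
      have h2 := congrArg (fun q => q.coeff (P i).natDegree) h1
      have h3 : (taylor 1 (P i)).coeff (P i).natDegree = (P i).leadingCoeff := by
        have := leadingCoeff_taylor (1:ℂ) (P i)
        rwa [leadingCoeff, natDegree_taylor] at this
      simp only [P', coeff_sub, coeff_C_mul, h3, coeff_zero] at h2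
      rw [coeff_natDegree, ← sub_mul, mul_eq_zero, leadingCoeff_eq_zero] at h2
      rcases h2 with h2 | h2
      · exact hii (hμ hi hi0 (sub_eq_zero.1 h2))
      · exact hp h2
    have h00 : P i0 = 0 := by
      by_contra hp
      have h1 := hz i0 hi0
      have e : P' i0 = C (μ i0) * (taylor 1 (P i0) - P i0) := by simp only [P']; ring
      rw [e, mul_eq_zero, C_eq_zero] at h1
      have h2 : taylor 1 (P i0) = P i0 := sub_eq_zero.1 (h1.resolve_left (hμ0 i0 hi0))
      have h3 : ∀ n : ℕ, (P i0).eval (n:ℂ) = (P i0).eval 0 := by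
        intro n
        induction n with
        | zero => simp
        | succ n ihn =>
          rw [← ihn]
          conv_rhs => rw [← h2, taylor_eval]
          push_cast; ring_nf
      have h4 := hs 0 (by omega)
      rw [Finset.sum_eq_single i0 (by
        intro i hi hii
        rw [hne i hi hii]; simp) (fun h => absurd hi0 h)] at h4
      simp at h4
      apply hp
      refine eq_zero_of_infinite_isRoot _ ?_
      refine Set.Infinite.mono ?_ (Set.infinite_range_of_injective (Nat.cast_injective (R := ℂ)))
      rintro _ ⟨n, rfl⟩
      simp [IsRoot, h3, h4]
    intro i hi
    by_cases hii : i = i0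
    · rw [hii]; exact h00
    · exact hne i hi hii

/-- the family of auxiliary functions -/
noncomputable def auxF {ι : Type*} [Fintype ι] (p : ι → ℂ) (Q : ι → ℂ[X]) (w l : ι → ℂ) (δ θ : ℂ)
    (ψ : ℂ → ℂ) (τ σ : ℕ) (z : ℂ) : ℂ :=
  ∑ i, p i * (derivative^[τ] (Q i)).eval z * w i ^ σ * Complex.exp (δ * w i * z + θ * l i * ψ z)

section
variable {ι : Type*} [Fintype ι] (p : ι → ℂ) (Q : ι → ℂ[X]) (w l : ι → ℂ) (δ θ : ℂ)
    (ψ : ℂ → ℂ)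

lemma auxF_diff (hψ : Differentiable ℂ ψ) (τ σ : ℕ) : Differentiable ℂ (auxF p Q w l δ θ ψ τ σ) := by
  unfold auxF
  fun_prop

lemma auxF_deriv (hψ : Differentiable ℂ ψ) (τ σ : ℕ) :
    deriv (auxF p Q w l δ θ ψ τ σ) = (auxF p Q w l δ θ ψ (τ+1) σ + 
      (fun z => δ * auxF p Q w l δ θ ψ τ (σ+1) z)) + 
      deriv ψ * (fun z => θ * auxF (fun i => p i * l i) Q w l δ θ ψ τ σ z) := by
  ext z
  have hex : ∀ i, HasDerivAt (fun z => Complex.exp (δ * w i * z + θ * l i * ψ z))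
      (Complex.exp (δ * w i * z + θ * l i * ψ z) * (δ * w i * 1 + θ * l i * deriv ψ z)) z := fun i =>
    (((hasDerivAt_id z).const_mul (δ * w i)).add ((hψ z).hasDerivAt.const_mul (θ * l i))).cexp
  have hp : ∀ i, HasDerivAt (fun z => (derivative^[τ] (Q i)).eval z)
    ((derivative^[τ+1] (Q i)).eval z) z := fun i => by
      rw [Function.iterate_succ_apply']
      exact (derivative^[τ] (Q i)).hasDerivAt z
  have : HasDerivAt (auxF p Q w l δ θ ψ τ σ) (∑ i, ((p i * ((derivative^[τ+1] (Q i)).eval z) * w i ^ σ) *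
      Complex.exp (δ * w i * z + θ * l i * ψ z) + p i * (derivative^[τ] (Q i)).eval z * w i ^ σ * 
      (Complex.exp (δ * w i * z + θ * l i * ψ z) * (δ * w i * 1 + θ * l i * deriv ψ z)))) z := by
    unfold auxF
    apply HasDerivAt.fun_sum
    intro i _
    exact (((hp i).const_mul (p i)).mul_const (w i ^ σ)).mul (hex i)
  rw [this.deriv]
  simp only [Pi.add_apply, Pi.mul_apply, auxF, Finset.mul_sum, ← Finset.sum_add_distrib]
  apply Finset.sum_congr rfl
  intro i _
  ring

lemma auxF_order (hψ : Differentiable ℂ ψ) (s : ℂ) (n : ℕ) (hψo : (n : ℕ∞) ≤ analyticOrderAt (deriv ψ) s)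
    (m : ℕ) (hm : m ≤ n) : ∀ T1 : ℕ, 
    (∀ τ σ, τ < T1 + m → σ < T1 + m → auxF p Q w l δ θ ψ τ σ s = 0) →
    ∀ τ σ, τ < T1 → σ < T1 → (m:ℕ∞) ≤ analyticOrderAt (auxF p Q w l δ θ ψ τ σ) s := by
  induction m with
  | zero => intros; simp
  | succ m ih =>
    intro T1 h τ σ hτ hσ
    have hd := auxF_diff p Q w l δ θ ψ hψ
    push_cast
    rw [← analyticOrderAt_deriv_ge_iff ((hd τ σ).analyticAt s) (h τ σ (by omega) (by omega)),
      auxF_deriv p Q w l δ θ ψ hψ]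
    have ih' := ih (by omega) (T1 + 1) (fun τ σ h1 h2 => h τ σ (by omega) (by omega))
    refine order_add_ge (order_add_ge (ih' _ _ (by omega) (by omega)) ?_) ?_
    · have := order_mul_ge (hd τ (σ+1)) (differentiable_const δ) (ih' τ (σ+1) (by omega) (by omega))
      rw [mul_comm] at this
      exact this
    · refine order_mul_ge hψ.deriv ?_ (le_trans (by exact_mod_cast (by omega)) hψo)
      exact (auxF_diff _ Q w l δ θ ψ hψ τ σ).const_mul θ
end
lemma siegel_wrap {α β : Type*} [Fintype α] [Fintype β] (A : Matrix α β ℤ) (E : ℝ) (hE : 1 ≤ E)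
    (hA : ∀ i j, |(A i j : ℝ)| ≤ E) (h0 : 0 < Fintype.card α)
    (h2 : 2 * Fintype.card α ≤ Fintype.card β) :
    ∃ t : β → ℤ, t ≠ 0 ∧ (∀ i, ∑ j, A i j * t j = 0) ∧ ∀ j, |(t j : ℝ)| ≤ Fintype.card β * E := by
  let _ := @Matrix.seminormedAddCommGroup α β ℤ _ _ _
  obtain ⟨t, ht, hAt, hb⟩ := Int.Matrix.exists_ne_zero_int_vec_norm_le A (by omega) h0
  refine ⟨t, ht, fun i => congrFun hAt i, fun j => ?_⟩
  have hnA : ‖A‖ ≤ E := by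
    rw [Matrix.norm_le_iff (by linarith)]
    intro i j
    rw [Int.norm_eq_abs]; exact hA i j
  have h1 : |(t j : ℝ)| ≤ ‖t‖ := by
    rw [← Int.norm_eq_abs]; exact norm_le_pi_norm t j
  refine h1.trans (hb.trans ?_)
  have hc0 : (0:ℝ) < Fintype.card α := by exact_mod_cast h0
  have hc : (2:ℝ) * Fintype.card α ≤ Fintype.card β := by exact_mod_cast h2
  have hn1 : (1:ℝ) ≤ Fintype.card β := by
    have : 1 ≤ Fintype.card β := by omega
    exact_mod_cast this
  have hbase : (1:ℝ) ≤ Fintype.card β * max 1 ‖A‖ := by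
    have : (1:ℝ) ≤ max 1 ‖A‖ := le_max_left _ _
    nlinarith
  calc _ ≤ ((Fintype.card β : ℝ) * max 1 ‖A‖) ^ (1:ℝ) := by
        apply Real.rpow_le_rpow_of_exponent_le hbase
        rw [div_le_one (by linarith)]
        linarith
    _ = (Fintype.card β : ℝ) * max 1 ‖A‖ := Real.rpow_one _
    _ ≤ _ := by
        gcongr
        exact max_le hE hnA

lemma two_pow_le_exp (n : ℕ) : (2:ℝ) ^ n ≤ Real.exp n := by
  have : Real.exp n = Real.exp 1 ^ n := by rw [← Real.exp_nat_mul]; ring_nf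
  rw [this]
  gcongr
  linarith [Real.exp_one_gt_d9]

lemma lcm_bound (h : ℕ) : (Nat.lcmUpto h : ℝ) ≤ Real.exp (6 * h) := by
  have h1 := Chebyshev.psi_eq_log_lcmUpto h
  have h2 := Chebyshev.psi_le_const_mul_self (x := (h:ℝ)) (by positivity)
  have hpos : (0:ℝ) < Nat.lcmUpto h := by exact_mod_cast Nat.lcmUpto_pos h
  rw [← Real.exp_log hpos, ← h1]
  apply Real.exp_le_exp.2
  refine h2.trans ?_
  gcongr
  have : Real.log 4 = 2 * Real.log 2 := by
    rw [show (4:ℝ) = 2 ^ 2 by norm_num, Real.log_pow]; norm_num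
  linarith [Real.log_two_lt_d9]

lemma fq_comb_zero (h n : ℕ) (t : Fin n → ℂ) (H : ∑ j, C (t j) * fq h j = 0) : ∀ j, t j = 0 := by
  let S : Polynomial.Sequence ℂ := ⟨fun j => fq h j, fun j => fq_degree h j⟩
  have hl := S.linearIndependent
  have hl2 := hl.comp (fun j : Fin n => (j:ℕ)) Fin.val_injective
  rw [Fintype.linearIndependent_iff] at hl2
  apply hl2 t
  simpa [smul_eq_C_mul] using H

set_option maxHeartbeats 4000000 in
lemma core_abs (p q A K l0 L T0 T a h b1 b2 : ℕ) (hp : 2 ≤ p) (hq : 2 ≤ q)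
    (hinj : ∀ x y x' y' : ℕ, p ^ x * q ^ y = p ^ x' * q ^ y' → x = x' ∧ y = y')
    (hA : p + q + 1 ≤ A) (hb1 : 1 ≤ b1) (hh : 1 ≤ h) (hT0 : 1 ≤ T0) (ha : 1 ≤ a) (hK : 1 ≤ K)
    (hL : 1 ≤ L) (hl0 : 1 ≤ l0)
    (hT : T = 8 * T0) (hsieg : 2 * (T * (T * (a * h))) ≤ l0 * h * (L * L))
    (hfin : l0 * h * (L * L) ≤ a * K ^ 7 * h)
    (hmain : ∀ j < 7, (6 * h + 16 * h * T + 2 * (4 * a * K^(j+1) * h + 2 * h) * l0 +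
      2 * L * A * (4 * a * K^(j+1) * h) : ℝ) < (a * K ^ j * h) * T0)
    (hn : ((l0 * h * (L * L) : ℕ) : ℝ) ≤ Real.exp (2 * h))
    (hTf : (T.factorial : ℝ) ≤ Real.exp h)
    (hw : ((L * (b1 + b2) : ℕ) : ℝ) ≤ Real.exp (2 * h))
    (ψ : ℂ → ℂ) (hψ : Differentiable ℂ ψ) (hψs : ∀ s : ℕ, ψ s = s)
    (hψo : ∀ s : ℕ, (T0 : ℕ∞) ≤ analyticOrderAt (deriv ψ) s)
    (θ : ℝ) (hθ : θ = (b1 * Real.log p - b2 * Real.log q) / b1) (hθ1 : |θ| ≤ 1)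
    (hθψ : ∀ z : ℂ, ‖z‖ ≤ 4 * (a * K ^ 7 * h) → L * |θ| * ‖ψ z‖ ≤ 1) : False := by
  classical
  set d := Nat.lcmUpto h with hd
  have hd1 : 1 ≤ d := Nat.lcmUpto_pos h
  have hd1' : (1:ℝ) ≤ d := by exact_mod_cast hd1
  have hdb : (d:ℝ) ≤ Real.exp (6 * h) := lcm_bound h
  have hdd : ∀ m, 1 ≤ m → m ≤ h → m ∣ d := by
    intro m h1 h2
    rw [hd, Nat.lcmUpto]
    exact Finset.dvd_lcm (f := id) (Finset.mem_Icc.2 ⟨h1, h2⟩)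
  have hchoose := fun τ s j => fq_int h d hh hdd s j τ
  choose c hc using hchoose
  let ι := Fin (l0 * h) × Fin L × Fin L
  let wn : ι → ℕ := fun i => i.2.1 * b2 + i.2.2 * b1
  let μ : ι → ℕ := fun i => p ^ (i.2.1:ℕ) * q ^ (i.2.2:ℕ)
  have hLA : ∀ i : ι, (i.2.1 : ℝ) * Real.log p + i.2.2 * Real.log q + i.2.1 ≤ L * A := by
    intro i
    have h1 : (i.2.1 : ℝ) ≤ L := by exact_mod_cast i.2.1.2.le
    have h2 : (i.2.2 : ℝ) ≤ L := by exact_mod_cast i.2.2.2.le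
    have h3 : Real.log p ≤ p := Real.log_le_self (by positivity)
    have h4 : Real.log q ≤ q := Real.log_le_self (by positivity)
    have h5 : (p + q + 1 : ℝ) ≤ A := by exact_mod_cast hA
    have h6 : 0 ≤ Real.log p := Real.log_natCast_nonneg p
    have h7 : 0 ≤ Real.log q := Real.log_natCast_nonneg q
    calc _ ≤ (L:ℝ) * p + L * q + L := by gcongr
      _ = L * (p + q + 1) := by ring
      _ ≤ _ := by gcongr
  have hμexp : ∀ i : ι, (μ i : ℝ) = Real.exp (i.2.1 * Real.log p + i.2.2 * Real.log q) := by
    intro i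
    rw [Real.exp_add, Real.exp_nat_mul, Real.exp_nat_mul, Real.exp_log (by positivity),
      Real.exp_log (by positivity)]
    simp [μ]
  have hμb : ∀ (i : ι) (s : ℕ), (μ i : ℝ) ^ s ≤ Real.exp (L * A * s) := by
    intro i s
    rw [hμexp, ← Real.exp_nat_mul]
    apply Real.exp_le_exp.2
    rw [mul_comm]
    gcongr
    have := hLA i
    have h1 : (0:ℝ) ≤ i.2.1 := by positivity
    linarith
  have hwb : ∀ (i : ι) (σ : ℕ), σ < T → (wn i : ℝ) ^ σ ≤ Real.exp (2 * h * T) := by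
    intro i σ hσ
    have h1 : (wn i : ℝ) ≤ Real.exp (2 * h) := by
      refine le_trans ?_ hw
      have : wn i ≤ L * (b1 + b2) := by
        simp only [wn]
        have := Nat.mul_le_mul_right b2 i.2.1.2.le
        have := Nat.mul_le_mul_right b1 i.2.2.2.le
        rw [mul_add]; omega
      exact_mod_cast this
    calc (wn i : ℝ) ^ σ ≤ (Real.exp (2 * h)) ^ σ := by gcongr
      _ ≤ (Real.exp (2 * h)) ^ T := by
        gcongr
        exact Real.one_le_exp (by positivity)
      _ = _ := by rw [← Real.exp_nat_mul]; ring_nf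
  have hdT : ∀ τ, τ < T → (d:ℝ) ^ τ ≤ Real.exp (6 * h * T) := by
    intro τ hτ
    calc (d : ℝ) ^ τ ≤ (d:ℝ) ^ T := by gcongr
      _ ≤ (Real.exp (6 * h)) ^ T := by gcongr
      _ = _ := by rw [← Real.exp_nat_mul]; ring_nf
  have hh' : (1:ℝ) ≤ h := by exact_mod_cast hh
  -- bounds for the integers c
  have hcb : ∀ τ s j, τ < T → s < a * h → j < l0 * h → |(c τ s j : ℝ)| ≤
      Real.exp (6 * h * T) * Real.exp ((a * h + 2 * h) * l0) := by
    intro τ s j hτ hs hj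
    have h1 := fq_deriv_bound h l0 j (a * h + 1) hh hj τ s (by
      rw [Complex.norm_natCast]; push_cast
      have : (s:ℝ) ≤ (a * h : ℕ) := by exact_mod_cast hs.le
      push_cast at this
      linarith)
    have h2 := congrArg norm (hc τ s j)
    rw [norm_mul, norm_mul, norm_pow, Complex.norm_natCast, Complex.norm_natCast, Complex.norm_intCast] at h2
    have hf : (0:ℝ) < τ.factorial := by positivity
    have h3 : (2:ℝ) ^ ((a * h + 1 + h) * l0) ≤ Real.exp ((a * h + 2 * h) * l0) := by
      refine (two_pow_le_exp _).trans (Real.exp_le_exp.2 ?_)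
      push_cast
      refine mul_le_mul_of_nonneg_right ?_ (by positivity)
      linarith
    have h4 : (τ.factorial : ℝ) * |(c τ s j : ℝ)| ≤ τ.factorial * (Real.exp (6 * h * T) * Real.exp ((a * h + 2 * h) * l0)) := by
      rw [← h2]
      calc _ ≤ Real.exp (6 * h * T) * (τ.factorial * Real.exp ((a * h + 2 * h) * l0)) := by
            gcongr
            · exact hdT τ hτ
            · exact h1.trans (by gcongr)
        _ = _ := by ring
    exact le_of_mul_le_mul_left h4 hf
  -- Siegel
  let Mx : Matrix (Fin T × Fin T × Fin (a * h)) ι ℤ := fun r i =>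
    c r.1 r.2.2 i.1 * (wn i : ℤ) ^ (r.2.1 : ℕ) * (μ i : ℤ) ^ (r.2.2 : ℕ)
  set E : ℝ := Real.exp (8 * h * T + (a * h + 2 * h) * l0 + L * A * (a * h)) with hE
  have hT1 : 1 ≤ T := by omega
  have hcardι : Fintype.card ι = l0 * h * (L * L) := by simp [ι]
  obtain ⟨t, ht0, hteq, htb⟩ := siegel_wrap Mx E (Real.one_le_exp (by positivity)) (by
    intro r i
    simp only [Mx]
    push_cast
    rw [abs_mul, abs_mul, abs_pow, abs_pow, Nat.abs_cast, Nat.abs_cast]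
    have e1 : E = Real.exp (6 * h * T) * Real.exp ((a * h + 2 * h) * l0) * Real.exp (2 * h * T) *
        Real.exp (L * A * (a * h)) := by
      rw [hE, ← Real.exp_add, ← Real.exp_add, ← Real.exp_add]; ring_nf
    rw [e1]
    gcongr
    · exact hcb _ _ _ r.1.2 r.2.2.2 i.1.2
    · exact hwb i _ r.2.1.2
    · refine (hμb i _).trans (Real.exp_le_exp.2 ?_)
      gcongr
      exact_mod_cast r.2.2.2.le) (by
    simp only [Fintype.card_prod, Fintype.card_fin]; positivity) (by
    rw [hcardι]; simpa only [Fintype.card_prod, Fintype.card_fin] using hsieg)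
  rw [hcardι] at htb
  let Φ : ℕ → ℕ → ℕ → ℤ := fun τ σ s => ∑ i : ι, c τ s i.1 * (wn i : ℤ) ^ σ * (μ i : ℤ) ^ s * t i
  -- auxiliary functions
  have hb1' : (b1:ℝ) ≠ 0 := by
    have : b1 ≠ 0 := by omega
    exact_mod_cast this
  let δ : ℝ := Real.log q / b1
  let F : ℕ → ℕ → ℂ → ℂ := auxF (fun i : ι => (t i : ℂ)) (fun i => fq h i.1) (fun i => (wn i : ℂ))
    (fun i => ((i.2.1 : ℕ) : ℂ)) δ θ ψ
  have hδ : ∀ i : ι, δ * wn i = i.2.1 * Real.log p + i.2.2 * Real.log q - i.2.1 * θ := by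
    intro i
    simp only [δ, wn, hθ]
    push_cast
    field_simp
    ring
  have hFΦ : ∀ τ σ (s : ℕ), (d:ℂ) ^ τ * F τ σ s = τ.factorial * (Φ τ σ s : ℂ) := by
    intro τ σ s
    simp only [F, auxF, Φ]
    push_cast
    rw [Finset.mul_sum, Finset.mul_sum]
    apply Finset.sum_congr rfl
    intro i _
    have e1 : Complex.exp (δ * wn i * s + θ * ((i.2.1 : ℕ) : ℂ) * ψ s) = (μ i : ℂ) ^ s := by
      rw [hψs]
      have : (δ * wn i * s + θ * ((i.2.1 : ℕ) : ℂ) * s : ℂ) =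
        ((s * (i.2.1 * Real.log p + i.2.2 * Real.log q) : ℝ) : ℂ) := by
        have e2 := hδ i
        have e3 : (δ * wn i * s + θ * ((i.2.1 : ℕ)) * s : ℝ) = (s * (i.2.1 * Real.log p + i.2.2 * Real.log q) : ℝ) := by
          rw [e2]; ring
        exact_mod_cast e3
      rw [this, ← Complex.ofReal_exp, Real.exp_nat_mul, ← hμexp]
      push_cast; rfl
    rw [e1]
    linear_combination (t i * (wn i:ℂ) ^ σ * (μ i : ℂ) ^ s) * hc τ s i.1
  -- bound for F
  have hFb : ∀ j < 7, ∀ τ σ, τ < T → σ < T → ∀ z : ℂ, ‖z‖ ≤ 4 * (a * K ^ (j+1) * h : ℕ) →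
      ‖F τ σ z‖ ≤ Real.exp (6 * h + 10 * h * T + 2 * (4 * a * K^(j+1) * h + 2 * h) * l0 +
        2 * L * A * (4 * a * K^(j+1) * h)) := by
    intro j hj τ σ hτ hσ z hz
    set R : ℕ := 4 * (a * K ^ (j+1) * h) with hR
    have hzR : ‖z‖ ≤ R := by rw [hR]; push_cast; push_cast at hz; exact hz
    have hRa : (a * h : ℝ) ≤ R := by
      have : a * h ≤ R := by
        rw [hR]
        have : 1 ≤ K ^ (j+1) := Nat.one_le_pow _ _ hK
        nlinarith [Nat.zero_le (a*h), Nat.mul_le_mul_left (a*h) this]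
      exact_mod_cast this
    have hterm : ∀ i : ι, ‖(t i : ℂ) * (derivative^[τ] (fq h i.1)).eval z * (wn i : ℂ) ^ σ *
        Complex.exp (δ * wn i * z + θ * ((i.2.1 : ℕ) : ℂ) * ψ z)‖ ≤
        (Real.exp (2 * h) * E) * (Real.exp h * Real.exp ((R + 2 * h) * l0)) * Real.exp (2 * h * T) *
          Real.exp (L * A * R + 1) := by
      intro i
      rw [norm_mul, norm_mul, norm_mul, norm_pow, Complex.norm_natCast, Complex.norm_intCast]
      gcongr
      · refine (htb i).trans ?_
        gcongr
      · refine (fq_deriv_bound h l0 i.1 (R + 1) hh i.1.2 τ z (by push_cast; linarith)).trans ?_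
        gcongr
        · refine le_trans ?_ hTf
          exact_mod_cast Nat.factorial_le hτ.le
        · refine (two_pow_le_exp _).trans (Real.exp_le_exp.2 ?_)
          push_cast
          refine mul_le_mul_of_nonneg_right ?_ (by positivity)
          linarith
      · exact hwb i σ hσ
      · rw [Complex.norm_exp]
        apply Real.exp_le_exp.2
        refine (Complex.re_le_norm _).trans ((norm_add_le _ _).trans ?_)
        gcongr
        · rw [norm_mul]
          gcongr
          rw [← Complex.ofReal_natCast, ← Complex.ofReal_mul, Complex.norm_real, Real.norm_eq_abs, hδ, abs_le]
          have h1 := hLA i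
          have h2 := abs_le.1 hθ1
          have h3 : (0:ℝ) ≤ i.2.1 := by positivity
          have h4 : 0 ≤ Real.log p := Real.log_natCast_nonneg p
          have h5 : 0 ≤ Real.log q := Real.log_natCast_nonneg q
          have h6 : 0 ≤ (i.2.1:ℝ) * Real.log p + i.2.2 * Real.log q := by positivity
          constructor <;> nlinarith
        · rw [norm_mul, norm_mul, Complex.norm_real, Complex.norm_natCast, Real.norm_eq_abs]
          have hz7 : ‖z‖ ≤ 4 * (a * K ^ 7 * h) := by
            refine hz.trans ?_
            push_cast
            gcongr
            · exact_mod_cast hK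
            · omega
          refine le_trans ?_ (hθψ z hz7)
          have h1 : (i.2.1 : ℝ) ≤ L := by exact_mod_cast i.2.1.2.le
          rw [mul_comm |θ|]
          gcongr
    simp only [F, auxF]
    refine (norm_sum_le _ _).trans ((Finset.sum_le_sum (fun i _ => hterm i)).trans ?_)
    rw [Finset.sum_const, Finset.card_univ, hcardι, nsmul_eq_mul]
    calc _ ≤ Real.exp (2 * h) * ((Real.exp (2 * h) * E) * (Real.exp h * Real.exp ((R + 2 * h) * l0)) * Real.exp (2 * h * T) *
          Real.exp (L * A * R + 1)) := by gcongr
      _ = Real.exp (5 * h + 1 + 10 * h * T + ((a * h + 2 * h) * l0 + (R + 2 * h) * l0) + (L * A * (a * h) + L * A * R)) := by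
          rw [hE]; simp only [← Real.exp_add]; ring_nf
      _ ≤ _ := by
          apply Real.exp_le_exp.2
          have e : (R:ℝ) = 4 * a * K^(j+1) * h := by rw [hR]; push_cast; ring
          rw [← e]
          have h1 : (a * h + 2 * h : ℝ) * l0 ≤ (R + 2 * h) * l0 := by gcongr
          have h2 : (L * A * (a * h) : ℝ) ≤ L * A * R := by gcongr
          linarith
  -- extrapolation
  have hext : ∀ j ≤ 7, ∀ τ σ, τ < (8 - j) * T0 → σ < (8 - j) * T0 → ∀ s < a * K ^ j * h, Φ τ σ s = 0 := by
    intro j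
    induction j with
    | zero =>
      intro _ τ σ hτ hσ s hs
      simp only [pow_zero, mul_one, Nat.sub_zero] at hs hτ hσ
      rw [← hT] at hτ hσ
      exact hteq (⟨τ, hτ⟩, ⟨σ, hσ⟩, ⟨s, hs⟩)
    | succ j ih =>
      intro hj τ σ hτ hσ x hx
      have e8 : (8 - j) * T0 = (8 - (j+1)) * T0 + T0 := by
        have : 8 - j = (8 - (j+1)) + 1 := by omega
        rw [this]; ring
      have hTle : (8 - (j+1)) * T0 ≤ T := by
        rw [hT]; exact Nat.mul_le_mul_right _ (by omega)
      have hτT : τ < T := by omega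
      have hσT : σ < T := by omega
      have hF0 : ∀ τ σ, τ < (8 - (j+1)) * T0 + T0 → σ < (8 - (j+1)) * T0 + T0 → ∀ s < a * K ^ j * h, F τ σ s = 0 := by
        intro τ σ h1 h2 s hs
        have h3 := ih (by omega) τ σ (by omega) (by omega) s hs
        have h4 := hFΦ τ σ s
        rw [h3, Int.cast_zero, mul_zero, mul_eq_zero] at h4
        refine h4.resolve_left (pow_ne_zero _ ?_)
        have : d ≠ 0 := by omega
        exact_mod_cast this
      have hord : ∀ s < a * K ^ j * h, (T0 : ℕ∞) ≤ analyticOrderAt (F τ σ) (s:ℂ) := by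
        intro s hs
        exact auxF_order _ _ _ _ _ _ _ hψ (s:ℂ) T0 (hψo s) T0 le_rfl ((8 - (j+1)) * T0)
          (fun τ σ h1 h2 => hF0 τ σ h1 h2 s hs) τ σ hτ hσ
      have hsch := schwarz T0 (a * K ^ j * h) (a * K ^ (j+1) * h) (by
          exact Nat.mul_le_mul_right _ (Nat.mul_le_mul_left _ (Nat.pow_le_pow_right hK (by omega)))) (by positivity) (F τ σ)
        (auxF_diff _ _ _ _ _ _ _ hψ τ σ) hord _ (hFb j (by omega) τ σ hτT hσT) x hx
      have h5 := congrArg norm (hFΦ τ σ x)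
      rw [norm_mul, norm_mul, norm_pow, Complex.norm_natCast, Complex.norm_natCast, Complex.norm_intCast] at h5
      have h6 : |(Φ τ σ x : ℝ)| < 1 := by
        calc |(Φ τ σ x : ℝ)| ≤ τ.factorial * |(Φ τ σ x : ℝ)| := by
              refine le_mul_of_one_le_left (abs_nonneg _) ?_
              exact_mod_cast Nat.one_le_iff_ne_zero.2 (Nat.factorial_ne_zero τ)
          _ = (d:ℝ) ^ τ * ‖F τ σ x‖ := h5.symm
          _ ≤ Real.exp (6 * h * T) * (Real.exp (6 * h + 10 * h * T + 2 * (4 * a * K^(j+1) * h + 2 * h) * l0 +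
        2 * L * A * (4 * a * K^(j+1) * h)) * Real.exp (-((a * K ^ j * h : ℕ) * T0 : ℝ))) := by
              gcongr
              exact hdT τ hτT
          _ = Real.exp ((6 * h + 16 * h * T + 2 * (4 * a * K^(j+1) * h + 2 * h) * l0 +
      2 * L * A * (4 * a * K^(j+1) * h) : ℝ) - (a * K ^ j * h) * T0) := by
              rw [← Real.exp_add, ← Real.exp_add]; push_cast; ring_nf
          _ < 1 := by
              rw [Real.exp_lt_one_iff]
              linarith [hmain j (by omega)]
      have h7 : |Φ τ σ x| < 1 := by exact_mod_cast h6
      exact Int.abs_lt_one_iff.1 h7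
  have hfinal := hext 7 le_rfl 0 0 (by omega) (by omega)
  -- zero estimate
  let P : Fin L × Fin L → ℂ[X] := fun u => ∑ j : Fin (l0 * h), C (t (j, u) : ℂ) * fq h j
  have hP := zero_estimate (Finset.univ : Finset (Fin L × Fin L)) (fun u => ((p ^ (u.1:ℕ) * q ^ (u.2:ℕ) : ℕ) : ℂ))
    (by
      intro u _ v _ huv
      have h1 : p ^ (u.1:ℕ) * q ^ (u.2:ℕ) = p ^ (v.1:ℕ) * q ^ (v.2:ℕ) := by
        simp only at huv
        exact_mod_cast huv
      obtain ⟨h2, h3⟩ := hinj _ _ _ _ h1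
      exact Prod.ext (Fin.ext h2) (Fin.ext h3)) (by
      intro u _
      have : p ^ (u.1:ℕ) * q ^ (u.2:ℕ) ≠ 0 := by positivity
      exact_mod_cast this) (l0 * h * (L * L)) (fun _ => l0 * h) P (by simp [mul_comm]) (by
      intro u _
      refine (degree_sum_le _ _).trans_lt ?_
      rw [Finset.sup_lt_iff (by exact WithBot.bot_lt_coe _)]
      intro j _
      rw [← smul_eq_C_mul]
      refine (degree_smul_le _ _).trans_lt ?_
      rw [fq_degree]
      exact_mod_cast j.2) (by
      intro s hs
      have h1 := hfinal s (by omega)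
      have h2 : ((Φ 0 0 s : ℤ) : ℂ) = 0 := by rw [h1]; simp
      rw [← h2]
      have h0 : Φ 0 0 s = ∑ u : Fin L × Fin L, ∑ j : Fin (l0 * h),
          c 0 s j * (wn (j, u) : ℤ) ^ 0 * (μ (j, u) : ℤ) ^ s * t (j, u) :=
        Fintype.sum_prod_type_right _
      rw [h0]
      simp only [P, μ]
      push_cast
      apply Finset.sum_congr rfl
      intro u _
      rw [eval_finsetSum, Finset.sum_mul]
      apply Finset.sum_congr rfl
      intro j _
      have h3 := hc 0 s j
      simp only [pow_zero, one_mul, Function.iterate_zero, id, Nat.factorial_zero, Nat.cast_one] at h3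
      rw [← h3]
      simp
      ring)
  apply ht0
  funext i
  obtain ⟨j, u⟩ := i
  have h1 := fq_comb_zero h (l0 * h) (fun j => (t (j, u) : ℂ)) (hP u (Finset.mem_univ u)) j
  exact_mod_cast h1

lemma params (A : ℕ) (hA : 1 ≤ A) : ∃ K l0 L T0 T a : ℕ, 1 ≤ K ∧ 1 ≤ l0 ∧ 1 ≤ L ∧ 1 ≤ T0 ∧ 1 ≤ a ∧
    T = 8 * T0 ∧ (∀ h : ℕ, 2 * (T * (T * (a * h))) ≤ l0 * h * (L * L)) ∧
    (∀ h : ℕ, l0 * h * (L * L) ≤ a * K ^ 7 * h) ∧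
    (∀ h : ℕ, 1 ≤ h → ∀ j < 7, (6 * h + 16 * h * T + 2 * (4 * a * K^(j+1) * h + 2 * h) * l0 +
      2 * L * A * (4 * a * K^(j+1) * h) : ℝ) < (a * K ^ j * h) * T0) := by
  obtain ⟨K, hK⟩ : ∃ K : ℕ, K = 2 ^ 73 * A ^ 6 := ⟨_, rfl⟩
  obtain ⟨l0, hl0⟩ : ∃ l0 : ℕ, l0 = 2 ^ 27 * A ^ 2 * K ^ 2 := ⟨_, rfl⟩
  obtain ⟨L, hL⟩ : ∃ L : ℕ, L = 2 * l0 := ⟨_, rfl⟩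
  obtain ⟨T0, hT0⟩ : ∃ T0 : ℕ, T0 = 32 * A * L * K := ⟨_, rfl⟩
  have hK1 : 1 ≤ K := by rw [hK]; exact Nat.succ_le_of_lt (by positivity)
  have hl1 : 1 ≤ l0 := by rw [hl0]; exact Nat.succ_le_of_lt (by positivity)
  have hL1 : 1 ≤ L := by omega
  have hT1 : 1 ≤ T0 := by rw [hT0]; exact Nat.succ_le_of_lt (by positivity)
  refine ⟨K, l0, L, T0, 8 * T0, 1024, hK1, hl1, hL1, hT1, by norm_num, rfl, ?_, ?_, ?_⟩
  · intro h
    apply le_of_eq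
    rw [hT0]
    have e : l0 * h * (L * L) = (2 ^ 27 * A ^ 2 * K ^ 2) * h * (L * L) := by rw [← hl0]
    rw [e]; ring
  · intro h
    have e : l0 * h * (L * L) = 1024 * (2 ^ 73 * A ^ 6) * K ^ 6 * h := by rw [hL, hl0]; ring
    rw [e, ← hK]
    apply le_of_eq; ring
  · intro h hh j _
    have hh' : (1:ℝ) ≤ h := by exact_mod_cast hh
    have hA' : (1:ℝ) ≤ A := by exact_mod_cast hA
    have hl' : (1:ℝ) ≤ l0 := by exact_mod_cast hl1
    have hT' : (1:ℝ) ≤ T0 := by exact_mod_cast hT1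
    have hKj : (1:ℝ) ≤ (K:ℝ) ^ j := one_le_pow₀ (by exact_mod_cast hK1)
    have hKj1 : (1:ℝ) ≤ (K:ℝ) ^ (j+1) := one_le_pow₀ (by exact_mod_cast hK1)
    have hTK : (T0:ℝ) = 64 * A * l0 * K := by rw [hT0, hL]; push_cast; ring
    have hLr : (L:ℝ) = 2 * l0 := by rw [hL]; push_cast; ring
    set X : ℝ := (K:ℝ) ^ j * h * T0 with hX
    have hX0 : 0 < X := by positivity
    have s0 : (h:ℝ) * T0 ≤ X := by
      rw [hX, mul_assoc]; exact le_mul_of_one_le_left (by positivity) hKj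
    have s00 : (h:ℝ) ≤ h * T0 := le_mul_of_one_le_right (by positivity) hT'
    have s1 : (K:ℝ) ^ (j+1) * h * l0 * 64 ≤ X := by
      have : X = ((K:ℝ) ^ (j+1) * h * l0 * 64) * A := by rw [hX, hTK]; ring
      rw [this]; exact le_mul_of_one_le_right (by positivity) hA'
    have s2 : (h:ℝ) * l0 ≤ (K:ℝ) ^ (j+1) * h * l0 := by
      rw [mul_assoc]; exact le_mul_of_one_le_left (by positivity) hKj1
    have s3 : 2 * (L:ℝ) * A * (4 * (1024:ℕ) * K^(j+1) * h) = 256 * X := by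
      rw [hX, hTK, hLr]; push_cast; ring
    rw [s3]
    push_cast
    have s4 : (1024 * (K:ℝ) ^ j * h) * T0 = 1024 * X := by rw [hX]; ring
    rw [s4]
    nlinarith

lemma core (p q : ℕ) (hp : 2 ≤ p) (hq : 2 ≤ q)
    (hinj : ∀ x y x' y' : ℕ, p ^ x * q ^ y = p ^ x' * q ^ y' → x = x' ∧ y = y') :
    ∃ C1 : ℝ, 0 < C1 ∧ ∃ H0 : ℕ, ∀ b1 b2 h : ℕ, 1 ≤ b1 → H0 ≤ h → (b1:ℝ) ≤ Real.exp h →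
      (b2:ℝ) ≤ Real.exp h → Real.exp (-C1 * h) < |b1 * Real.log p - b2 * Real.log q| := by
  obtain ⟨K, l0, L, T0, T, a, hK, hl0, hL, hT0, ha, hT, hs, hf, hm⟩ := params (p + q + 1) (by omega)
  obtain ⟨ψ, hψ, hψs, hψo, Cψ, hC, hψb⟩ := exists_psi T0
  refine ⟨1 + 5 * a * K ^ 7 * Cψ, by positivity, l0 * (L * L) + T.factorial + 2 * L + 1, ?_⟩
  intro b1 b2 h hb1 hH h1 h2
  by_contra hcon
  push Not at hcon
  have hhexp : (h:ℝ) ≤ Real.exp h := by linarith [Real.add_one_le_exp (h:ℝ)]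
  have hh : 1 ≤ h := by omega
  have hh' : (1:ℝ) ≤ h := by exact_mod_cast hh
  have ha' : (1:ℝ) ≤ a := by exact_mod_cast ha
  have hK' : (1:ℝ) ≤ (K:ℝ) ^ 7 := one_le_pow₀ (by exact_mod_cast hK)
  have e2 : Real.exp (2 * h) = Real.exp h * Real.exp h := by rw [← Real.exp_add]; ring_nf
  have hb1' : (1:ℝ) ≤ b1 := by exact_mod_cast hb1
  have hLh : (L:ℝ) ≤ Real.exp h := by
    refine le_trans ?_ hhexp
    exact_mod_cast (by omega : L ≤ h)
  have hθle : |((b1 * Real.log p - b2 * Real.log q) / b1 : ℝ)| ≤ Real.exp (-(1 + 5 * a * K ^ 7 * Cψ) * h) := by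
    rw [abs_div, abs_of_nonneg (by positivity : (0:ℝ) ≤ b1)]
    exact (div_le_self (abs_nonneg _) hb1').trans hcon
  refine core_abs p q (p + q + 1) K l0 L T0 T a h b1 b2 hp hq hinj le_rfl hb1 hh hT0 ha hK hL hl0 hT
    (hs h) (hf h) (hm h hh) ?_ ?_ ?_ ψ hψ hψs hψo _ rfl ?_ ?_
  · rw [e2]
    have : ((l0 * (L * L) : ℕ) : ℝ) ≤ Real.exp h := by
      refine le_trans ?_ hhexp
      exact_mod_cast (by omega : l0 * (L * L) ≤ h)
    calc ((l0 * h * (L * L) : ℕ) : ℝ) = ((l0 * (L * L) : ℕ) : ℝ) * h := by push_cast; ring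
      _ ≤ _ := by gcongr
  · refine le_trans ?_ hhexp
    exact_mod_cast (by omega : T.factorial ≤ h)
  · rw [e2]
    have : ((2 * L : ℕ) : ℝ) ≤ Real.exp h := by
      refine le_trans ?_ hhexp
      exact_mod_cast (by omega : 2 * L ≤ h)
    calc ((L * (b1 + b2) : ℕ) : ℝ) = L * (b1 + b2) := by push_cast; ring
      _ ≤ L * (Real.exp h + Real.exp h) := by gcongr
      _ = ((2 * L : ℕ) : ℝ) * Real.exp h := by push_cast; ring
      _ ≤ _ := by gcongr
  · refine hθle.trans (Real.exp_le_one_iff.2 ?_)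
    have : 0 ≤ (1 + 5 * a * K ^ 7 * Cψ) * h := by positivity
    linarith
  · intro z hz
    calc _ ≤ Real.exp h * Real.exp (-(1 + 5 * a * K ^ 7 * Cψ) * h) * Real.exp (Cψ * (5 * a * K ^ 7 * h)) := by
          gcongr
          refine (hψb z).trans (Real.exp_le_exp.2 ?_)
          gcongr
          have : (1:ℝ) ≤ a * K ^ 7 * h := one_le_mul_of_one_le_of_one_le (one_le_mul_of_one_le_of_one_le ha' hK') hh'
          linarith
      _ = 1 := by
          rw [← Real.exp_add, ← Real.exp_add]
          rw [Real.exp_eq_one_iff]; ring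

end TijdemanAux

lemma inj_of_primes (p q : ℕ) (hp : p.Prime) (hq : q.Prime) (hpq : p ≠ q) (x y x' y' : ℕ)
    (H : p ^ x * q ^ y = p ^ x' * q ^ y') : x = x' ∧ y = y' := by
  have key : ∀ x y, (p ^ x * q ^ y).factorization = Finsupp.single p x + Finsupp.single q y := by
    intro x y
    rw [Nat.factorization_mul (pow_ne_zero _ hp.ne_zero) (pow_ne_zero _ hq.ne_zero),
      hp.factorization_pow, hq.factorization_pow]
  have h := congrArg Nat.factorization H
  rw [key, key] at h
  have h1 := DFunLike.congr_fun h p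
  have h2 := DFunLike.congr_fun h q
  simp [hpq, hpq.symm] at h1 h2
  exact ⟨h1, h2⟩

lemma log_form (p q a b : ℕ) (hp : 2 ≤ p) (hq : 2 ≤ q) :
    Real.log ((p ^ a * q ^ b : ℕ) : ℝ) = a * Real.log p + b * Real.log q := by
  push_cast
  rw [Real.log_mul (by positivity) (by positivity), Real.log_pow, Real.log_pow]

lemma exps_le (p q a b : ℕ) (hp : 2 ≤ p) (hq : 2 ≤ q) (Y : ℝ)
    (h : Real.log ((p ^ a * q ^ b : ℕ) : ℝ) ≤ 2 * Y) : (a:ℝ) ≤ 4 * Y ∧ (b:ℝ) ≤ 4 * Y := by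
  rw [log_form p q a b hp hq] at h
  have hlp : (1/2:ℝ) ≤ Real.log p := by
    have : Real.log 2 ≤ Real.log p := Real.log_le_log (by norm_num) (by exact_mod_cast hp)
    linarith [Real.log_two_gt_d9]
  have hlq : (1/2:ℝ) ≤ Real.log q := by
    have : Real.log 2 ≤ Real.log q := Real.log_le_log (by norm_num) (by exact_mod_cast hq)
    linarith [Real.log_two_gt_d9]
  have h1 : (a:ℝ) * (1/2) ≤ a * Real.log p := by gcongr
  have h2 : (b:ℝ) * (1/2) ≤ b * Real.log q := by gcongr
  have h3 : (0:ℝ) ≤ a := by positivity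
  have h4 : (0:ℝ) ≤ b := by positivity
  constructor <;> linarith

theorem stmt_12 (p q : ℕ) (hp : p.Prime) (hq : q.Prime) (hpq : p ≠ q) :
    ∃ c : ℝ, 0 < c ∧ ∃ c' : ℝ, 0 < c' ∧ ∀ m m' : ℕ,
      (∃ a b : ℕ, m = p ^ a * q ^ b) → (∃ a b : ℕ, m' = p ^ a * q ^ b) →
      2 ≤ m → m < m' →
      (∀ x : ℕ, (∃ a b : ℕ, x = p ^ a * q ^ b) → ¬ (m < x ∧ x < m')) →
      c * (m : ℝ) / Real.log m ^ c' ≤ (m' : ℝ) - (m : ℝ) := by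
  have hp2 := hp.two_le
  have hq2 := hq.two_le
  obtain ⟨C1, hC1, H0, hcore⟩ := core p q hp2 hq2 (inj_of_primes p q hp hq hpq)
  have hl2 : 0 < Real.log 2 := Real.log_pos (by norm_num)
  refine ⟨min (Real.log 2 ^ C1) (Real.exp (-C1 * (H0 + 1)) * (4:ℝ) ^ (-C1)),
    lt_min (Real.rpow_pos_of_pos hl2 _) (by positivity), C1, hC1, ?_⟩
  rintro m m' ⟨a, b, hm⟩ ⟨a', b', hm'⟩ h2 hlt -
  have h2' : (2:ℝ) ≤ m := by exact_mod_cast h2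
  have hlm : Real.log 2 ≤ Real.log m := Real.log_le_log (by norm_num) h2'
  have hlm0 : 0 < Real.log m := by linarith
  have hpow : 0 < Real.log m ^ C1 := Real.rpow_pos_of_pos hlm0 _
  have hlt' : (m:ℝ) < m' := by exact_mod_cast hlt
  rw [div_le_iff₀ hpow]
  by_cases hbig : 2 * m ≤ m'
  · have hbig' : (2:ℝ) * m ≤ m' := by exact_mod_cast hbig
    have h3 : Real.log 2 ^ C1 ≤ Real.log m ^ C1 := Real.rpow_le_rpow hl2.le hlm hC1.le
    calc _ ≤ Real.log m ^ C1 * m := by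
          gcongr
          exact (min_le_left _ _).trans h3
      _ = m * Real.log m ^ C1 := mul_comm _ _
      _ ≤ _ := by gcongr; linarith
  · push Not at hbig
    have hbig' : (m':ℝ) < 2 * m := by exact_mod_cast hbig
    have hlm' : Real.log m' ≤ 2 * Real.log m := by
      have : Real.log m' ≤ Real.log (2 * m) := Real.log_le_log (by linarith) hbig'.le
      rw [Real.log_mul (by norm_num) (by linarith)] at this
      linarith
    set Y := 4 * Real.log m with hY
    have hY1 : 0 < Y := by positivity
    obtain ⟨ha, hb⟩ := exps_le p q a b hp2 hq2 (Real.log m) (by rw [← hm]; linarith)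
    obtain ⟨ha', hb'⟩ := exps_le p q a' b' hp2 hq2 (Real.log m) (by rw [← hm']; linarith)
    obtain ⟨h, hh⟩ : ∃ h, h = H0 + ⌈Real.log Y⌉₊ := ⟨_, rfl⟩
    have hYpos : Real.log Y ≥ 0 := by
      apply Real.log_nonneg
      rw [hY]; linarith [Real.log_two_gt_d9]
    have hexp : Y ≤ Real.exp h := by
      rw [← Real.log_le_iff_le_exp hY1, hh]
      push_cast
      have := Nat.le_ceil (Real.log Y)
      have : (0:ℝ) ≤ H0 := by positivity
      linarith
    have hhle : (h:ℝ) ≤ H0 + 1 + Real.log Y := by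
      rw [hh]; push_cast
      have := Nat.ceil_lt_add_one hYpos
      linarith
    have hlogm := log_form p q a b hp2 hq2
    have hlogm' := log_form p q a' b' hp2 hq2
    rw [← hm] at hlogm
    rw [← hm'] at hlogm'
    have hloglt : Real.log m < Real.log m' := Real.log_lt_log (by linarith) hlt'
    have hmain : Real.exp (-C1 * h) ≤ Real.log m' - Real.log m := by
      rcases lt_trichotomy a a' with haa | haa | haa
      · rcases le_or_gt b b' with hbb | hbb
        · exfalso
          have h3 : p * m ≤ m' := by
            rw [hm, hm']
            calc p * (p ^ a * q ^ b) = p ^ (a+1) * q ^ b := by ring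
              _ ≤ _ := Nat.mul_le_mul (Nat.pow_le_pow_right (by omega) haa)
                (Nat.pow_le_pow_right (by omega) hbb)
          nlinarith
        · obtain ⟨u, hu⟩ := Nat.exists_eq_add_of_lt haa
          obtain ⟨v, hv⟩ := Nat.exists_eq_add_of_lt hbb
          have h3 := hcore (u+1) (v+1) h (by omega) (by omega) (by
            refine le_trans ?_ (ha'.trans hexp)
            exact_mod_cast (by omega : u + 1 ≤ a')) (by
            refine le_trans ?_ (hb.trans hexp)
            exact_mod_cast (by omega : v + 1 ≤ b))
          have e : ((u+1:ℕ):ℝ) * Real.log p - ((v+1:ℕ):ℝ) * Real.log q = Real.log m' - Real.log m := by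
            rw [hlogm, hlogm', hu, hv]; push_cast; ring
          rw [e, abs_of_pos (by linarith)] at h3
          exact h3.le
      · exfalso
        subst haa
        rcases le_or_gt b' b with hbb | hbb
        · have h3 : m' ≤ m := by
            rw [hm, hm']
            exact Nat.mul_le_mul_left _ (Nat.pow_le_pow_right (by omega) hbb)
          omega
        · have h3 : q * m ≤ m' := by
            rw [hm, hm']
            calc q * (p ^ a * q ^ b) = p ^ a * q ^ (b+1) := by ring
              _ ≤ _ := Nat.mul_le_mul_left _ (Nat.pow_le_pow_right (by omega) hbb)
          nlinarith
      · rcases le_or_gt b' b with hbb | hbb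
        · exfalso
          have h3 : m' ≤ m := by
            rw [hm, hm']
            exact Nat.mul_le_mul (Nat.pow_le_pow_right (by omega) haa.le)
              (Nat.pow_le_pow_right (by omega) hbb)
          omega
        · obtain ⟨u, hu⟩ := Nat.exists_eq_add_of_lt haa
          obtain ⟨v, hv⟩ := Nat.exists_eq_add_of_lt hbb
          have h3 := hcore (u+1) (v+1) h (by omega) (by omega) (by
            refine le_trans ?_ (ha.trans hexp)
            exact_mod_cast (by omega : u + 1 ≤ a)) (by
            refine le_trans ?_ (hb'.trans hexp)
            exact_mod_cast (by omega : v + 1 ≤ b'))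
          have e : ((u+1:ℕ):ℝ) * Real.log p - ((v+1:ℕ):ℝ) * Real.log q = -(Real.log m' - Real.log m) := by
            rw [hlogm, hlogm', hu, hv]; push_cast; ring
          rw [e, abs_neg, abs_of_pos (by linarith)] at h3
          exact h3.le
    have hm0 : (0:ℝ) < m := by linarith
    have hgap : (m:ℝ) * (Real.log m' - Real.log m) ≤ m' - m := by
      rw [← Real.log_div (by linarith) hm0.ne']
      have h3 := Real.log_le_sub_one_of_pos (x := (m':ℝ) / m) (by apply div_pos <;> linarith)
      calc (m:ℝ) * Real.log (m' / m) ≤ m * (m' / m - 1) := by gcongr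
        _ = m' - m := by field_simp
    have hlow : Real.exp (-C1 * (H0 + 1)) * (4:ℝ) ^ (-C1) ≤ Real.exp (-C1 * h) * Real.log m ^ C1 := by
      have e1 : (4:ℝ) ^ (-C1) = Real.exp (-C1 * Real.log 4) := by
        rw [Real.rpow_def_of_pos (by norm_num)]; ring_nf
      have e2 : Real.log m ^ C1 = Real.exp (C1 * Real.log (Real.log m)) := by
        rw [Real.rpow_def_of_pos hlm0]; ring_nf
      have e3 : Real.log Y = Real.log 4 + Real.log (Real.log m) := by
        rw [hY, Real.log_mul (by norm_num) hlm0.ne']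
      rw [e1, e2, ← Real.exp_add, ← Real.exp_add]
      apply Real.exp_le_exp.2
      rw [e3] at hhle
      nlinarith
    calc _ ≤ (Real.exp (-C1 * h) * Real.log m ^ C1) * m := by
          gcongr
          exact (min_le_right _ _).trans hlow
      _ = (m * Real.exp (-C1 * h)) * Real.log m ^ C1 := by ring
      _ ≤ _ := by
          gcongr
          refine le_trans ?_ hgap
          gcongr
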